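/- arXiv:2411.07499 — 3 statements merged into one kernel-verified Lean document; each statement's English description precedes it below -/
import Mathlib

section
/- Let G be a finite simple graph, let v be a vertex of G, let S ⊆ N(v), and let X and Z be vertex sets such that the sets S, X, Z, and {v} are pairwise disjoint. Suppose every w ∈ X has exactly one neighbor in S. Let μ ≥ 1 be a real number and let P be the number of triples (r₁, z, r₂) with r₁, r₂ ∈ S distinct and z ∈ Z such that |N(z) ∩ N(r₁) ∩ X| ≥ μ and |N(z) ∩ N(r₂) ∩ X| ≥ μ. Then the number of copies of C_6 in G containing the vertex v is at least μ²·P/2. -/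
open SimpleGraph

/-- The number of copies of the hexagon `C₆` in `G` containing the vertex `v`. -/
noncomputable def hexCountAt {V : Type*} (G : SimpleGraph V) (v : V) : ℕ :=
  {H : G.Subgraph | v ∈ H.verts ∧ Nonempty (H.coe ≃g cycleGraph 6)}.ncard

/-- Two copies of the hexagon with the same image and the same base point agree up to reflection. -/
theorem hexagon_copy_eq_or_reflect {V : Type*} {G : SimpleGraph V} (c d : Copy (cycleGraph 6) G)
    (h0 : d 0 = c 0) (h : d.toSubgraph = c.toSubgraph) :
    (∀ i, d i = c i) ∨ ∀ i, d i = c (-i) := by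
  have hadj : ∀ i j, (cycleGraph 6).Adj i j →
      ∃ a b, (cycleGraph 6).Adj a b ∧ c a = d i ∧ c b = d j := by
    intro i j hij
    have hd : d.toSubgraph.Adj (d i) (d j) := ⟨i, j, hij, rfl, rfl⟩
    rw [h] at hd
    exact hd
  have hex : ∀ i, ∃ a, c a = d i := by
    intro i
    obtain ⟨a, -, -, ha, -⟩ := hadj i (i + 1) (by revert i; decide)
    exact ⟨a, ha⟩
  choose s hs using hex
  have s0 : s 0 = 0 := c.injective ((hs 0).trans h0)
  have sadj : ∀ i j, (cycleGraph 6).Adj i j → (cycleGraph 6).Adj (s i) (s j) := by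
    intro i j hij
    obtain ⟨a, b, hab, ha, hb⟩ := hadj i j hij
    rwa [c.injective ((hs i).trans ha.symm), c.injective ((hs j).trans hb.symm)]
  have sinj : ∀ i j, s i = s j → i = j := fun i j hij =>
    d.injective ((hs i).symm.trans ((congrArg c hij).trans (hs j)))
  have hturn : ∀ a b e : Fin 6, (cycleGraph 6).Adj a b → (cycleGraph 6).Adj b e → a ≠ e →
      e = b + b - a := by decide
  have hskip : ∀ i : Fin 6, i ≠ i + 1 + 1 := by decide
  have hstart : ∀ a : Fin 6, (cycleGraph 6).Adj 0 a → a = 1 ∨ a = 5 := by decide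
  have h1 := hstart (s 1) (s0 ▸ sadj 0 1 (by decide))
  have step : ∀ i, s (i + 1 + 1) = s (i + 1) + s (i + 1) - s i := fun i =>
    hturn _ _ _ (sadj _ _ (by revert i; decide)) (sadj _ _ (by revert i; decide))
      fun hi => hskip i (sinj _ _ hi)
  have e2 : s 2 = s 1 + s 1 - s 0 := step 0
  have e3 : s 3 = s 2 + s 2 - s 1 := step 1
  have e4 : s 4 = s 3 + s 3 - s 2 := step 2
  have e5 : s 5 = s 4 + s 4 - s 3 := step 3
  refine h1.imp (fun h1 i => ?_) (fun h1 i => ?_) <;>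
  · rw [h1, s0] at e2
    rw [e2, h1] at e3
    rw [e3, e2] at e4
    rw [e4, e3] at e5
    rw [← hs i]
    refine congrArg c ?_
    fin_cases i
    exacts [s0, h1, e2, e3, e4, e5]

/-- An injective closed walk with six vertices is a copy of the hexagon. -/
theorem exists_hexagon_copy {V : Type*} {G : SimpleGraph V} (f : Fin 6 → V)
    (hf : Function.Injective f) (hadj : ∀ i, G.Adj (f i) (f (i + 1))) :
    ∃ c : Copy (cycleGraph 6) G, ⇑c = f := by
  have hc : ∀ i j : Fin 6, (cycleGraph 6).Adj i j → j = i + 1 ∨ i = j + 1 := by decide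
  refine ⟨⟨⟨f, fun {i j} hij => ?_⟩, hf⟩, rfl⟩
  obtain rfl | rfl := hc i j hij
  · exact hadj i
  · exact (hadj j).symm

/-- Counting hexagons through `v` when every `w ∈ X` has exactly one neighbor in
`S ⊆ N(v)`, from triples `(r₁, z, r₂)` with many common neighbors in `X`. -/
theorem hexagons_from_codegree_triples
    {V : Type} [Fintype V] (G : SimpleGraph V) (v : V) (S X Z : Set V)
    (hS : S ⊆ G.neighborSet v)
    (hSX : Disjoint S X) (hSZ : Disjoint S Z) (hXZ : Disjoint X Z)
    (hvS : v ∉ S) (hvX : v ∉ X) (hvZ : v ∉ Z)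
    (hone : ∀ w ∈ X, (G.neighborSet w ∩ S).ncard = 1)
    (μ : ℝ) (hμ : 1 ≤ μ)
    (P : ℕ)
    (hP : P = {p : V × V × V | p.1 ∈ S ∧ p.2.2 ∈ S ∧ p.1 ≠ p.2.2 ∧ p.2.1 ∈ Z ∧
      μ ≤ ((G.neighborSet p.2.1 ∩ G.neighborSet p.1 ∩ X).ncard : ℝ) ∧
      μ ≤ ((G.neighborSet p.2.1 ∩ G.neighborSet p.2.2 ∩ X).ncard : ℝ)}.ncard) :
    (hexCountAt G v : ℝ) ≥ μ ^ 2 * (P : ℝ) / 2 := by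
  classical
  set A : V × V → Set V := fun q => G.neighborSet q.2 ∩ G.neighborSet q.1 ∩ X with hA
  rw [Set.ncard_eq_toFinset_card'] at hP
  set Q := Set.toFinset {p : V × V × V | p.1 ∈ S ∧ p.2.2 ∈ S ∧ p.1 ≠ p.2.2 ∧ p.2.1 ∈ Z ∧
      μ ≤ ((G.neighborSet p.2.1 ∩ G.neighborSet p.1 ∩ X).ncard : ℝ) ∧
      μ ≤ ((G.neighborSet p.2.1 ∩ G.neighborSet p.2.2 ∩ X).ncard : ℝ)} with hQ
  set T : Finset (Σ _ : V × V × V, V × V) := Q.sigma fun p =>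
    (A (p.1, p.2.1)).toFinset ×ˢ (A (p.2.2, p.2.1)).toFinset with hT
  let φ : (Σ _ : V × V × V, V × V) → Fin 6 → V := fun t =>
    ![v, t.1.1, t.2.1, t.1.2.1, t.2.2, t.1.2.2]
  have hcopy : ∀ t ∈ T, ∃ c : Copy (cycleGraph 6) G, ⇑c = φ t := by
    rintro ⟨⟨r₁, z, r₂⟩, w₁, w₂⟩ ht
    simp only [hT, hQ, hA, Finset.mem_sigma, Set.mem_toFinset, Set.mem_ofPred_eq,
      Finset.mem_product, Set.mem_inter_iff, mem_neighborSet] at ht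
    obtain ⟨⟨hr₁, hr₂, hr, hz, -, -⟩, ⟨⟨hzw₁, hrw₁⟩, hw₁⟩, ⟨hzw₂, hrw₂⟩, hw₂⟩ := ht
    have hw : w₁ ≠ w₂ := by
      rintro rfl
      obtain ⟨a, ha⟩ := Set.ncard_eq_one.1 (hone w₁ hw₁)
      have h₁ : r₁ ∈ ({a} : Set V) := ha ▸ ⟨hrw₁.symm, hr₁⟩
      have h₂ : r₂ ∈ ({a} : Set V) := ha ▸ ⟨hrw₂.symm, hr₂⟩
      exact hr (h₁.trans h₂.symm)
    have hv₁ : G.Adj v r₁ := hS hr₁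
    have hv₂ : G.Adj v r₂ := hS hr₂
    have d₁ := hSX.ne_of_mem hr₁ hw₂
    have d₂ := hSX.ne_of_mem hr₂ hw₁
    have d₃ := hSZ.ne_of_mem hr₁ hz
    have d₄ := hSZ.ne_of_mem hr₂ hz
    have dX {w} (h : w ∈ X) : v ≠ w := fun e => hvX (e ▸ h)
    have dZ : v ≠ z := fun e => hvZ (e ▸ hz)
    apply exists_hexagon_copy
    · rw [← List.nodup_ofFn]
      simp [φ, hw, hr, d₁, d₂.symm, d₃, d₄.symm, dX hw₁, dX hw₂, dZ, hv₁.ne, hv₂.ne, hzw₁.ne',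
        hzw₂.ne, hrw₁.ne, hrw₂.ne']
    · intro i
      fin_cases i
      exacts [hv₁, hrw₁, hzw₁.symm, hzw₂, hrw₂.symm, hv₂.symm]
  have hsub : ∀ t, ∃ H : G.Subgraph, t ∈ T →
      ∃ c : Copy (cycleGraph 6) G, ⇑c = φ t ∧ H = c.toSubgraph := by
    intro t
    by_cases ht : t ∈ T
    · obtain ⟨c, hc⟩ := hcopy t ht
      exact ⟨c.toSubgraph, fun _ => ⟨c, hc, rfl⟩⟩
    · exact ⟨⊥, fun h => absurd h ht⟩
  choose F hF using hsub
  have himage : (T.image F).card ≤ hexCountAt G v := by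
    rw [hexCountAt, ← Set.ncard_coe_finset]
    refine Set.ncard_le_ncard (fun H hH => ?_) (Set.toFinite _)
    obtain ⟨t, ht, rfl⟩ := Finset.mem_image.1 (Finset.mem_coe.1 hH)
    obtain ⟨c, hc, hFc⟩ := hF t ht
    rw [hFc]
    refine ⟨?_, ⟨c.isoToSubgraph.symm⟩⟩
    have h0 : c 0 = v := by rw [hc]; rfl
    exact ⟨0, trivial, h0⟩
  have hfiber : T.card ≤ 2 * (T.image F).card := by
    refine Finset.card_le_mul_card_image T 2 fun H hH => ?_
    obtain ⟨t, ht, rfl⟩ := Finset.mem_image.1 hH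
    refine (Finset.card_le_card (t := {t, ⟨(t.1.2.2, t.1.2.1, t.1.1), t.2.2, t.2.1⟩})
      fun u hu => ?_).trans Finset.card_le_two
    obtain ⟨huT, hu⟩ := Finset.mem_filter.1 hu
    obtain ⟨c, hc, hFc⟩ := hF t ht
    obtain ⟨d, hd, hFd⟩ := hF u huT
    have h := hexagon_copy_eq_or_reflect c d (by rw [hc, hd]; rfl) (by rw [← hFc, ← hFd, hu])
    rw [hc, hd] at h
    obtain ⟨⟨r₁, z, r₂⟩, w₁, w₂⟩ := t
    obtain ⟨⟨s₁, y, s₂⟩, x₁, x₂⟩ := u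
    rw [Finset.mem_insert, Finset.mem_singleton]
    refine h.imp (fun h => ?_) (fun h => ?_) <;>
    · obtain rfl : s₁ = _ := h 1
      obtain rfl : x₁ = _ := h 2
      obtain rfl : y = _ := h 3
      obtain rfl : x₂ = _ := h 4
      obtain rfl : s₂ = _ := h 5
      rfl
  have hcard : μ ^ 2 * (P : ℝ) ≤ T.card := by
    rw [hT, Finset.card_sigma, hP, Nat.cast_sum, mul_comm, ← nsmul_eq_mul]
    refine Finset.card_nsmul_le_sum _ _ _ fun p hp => ?_
    obtain ⟨-, -, -, -, h₁, h₂⟩ := Set.mem_toFinset.1 hp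
    rw [Finset.card_product, ← Set.ncard_eq_toFinset_card', ← Set.ncard_eq_toFinset_card',
      Nat.cast_mul, sq]
    exact mul_le_mul h₁ h₂ (by linarith) (Nat.cast_nonneg _)
  have hle : (T.card : ℝ) ≤ 2 * hexCountAt G v := by
    exact_mod_cast hfiber.trans (Nat.mul_le_mul_left 2 himage)
  linarith
end

section
/- There exists an absolute constant c > 0 such that the following holds. Let G be a finite simple bipartite graph with vertex parts A and B of sizes L ≥ 1 and R ≥ 1 respectively, and with m edges. If m ≥ 50(R + L), then the number of 5-tuples (a₁, b₁, a₂, b₂, a₃) with a₁, a₂, a₃ ∈ A pairwise distinct, b₁, b₂ ∈ B distinct, and with a₁b₁, b₁a₂, a₂b₂, b₂a₃ all edges of G, is at least c·m⁴/(L·R²). -/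
open SimpleGraph

/-- Removing one element of maximal weight from `H` leaves a set whose squared weight is at most the
off-diagonal part of the squared weight of `H`. -/
theorem exists_subset_sq_sum_le_sum_offDiag {V : Type*} [DecidableEq V] (H : Finset V) (w : V → ℝ)
    (hw : ∀ v, 0 ≤ w v) :
    ∃ K ⊆ H, H.card ≤ K.card + 1 ∧
      (∑ b ∈ K, w b) ^ 2 ≤ ∑ b ∈ H, ∑ b' ∈ H.erase b, w b * w b' := by
  rcases H.eq_empty_or_nonempty with rfl | hne
  · exact ⟨∅, by simp⟩
  obtain ⟨x, hx, hmax⟩ := H.exists_max_image w hne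
  refine ⟨H.erase x, H.erase_subset x, by rw [Finset.card_erase_add_one hx], ?_⟩
  calc (∑ b ∈ H.erase x, w b) ^ 2
      = ∑ b ∈ H.erase x, w b * ∑ b' ∈ H.erase x, w b' := by rw [sq, Finset.sum_mul]
    _ ≤ ∑ b ∈ H.erase x, w b * ∑ b' ∈ H.erase b, w b' := by
        refine Finset.sum_le_sum fun b hb => mul_le_mul_of_nonneg_left ?_ (hw b)
        have h1 := Finset.add_sum_erase H w hx
        have h2 := Finset.add_sum_erase H w (Finset.mem_of_mem_erase hb)
        have h3 := hmax b (Finset.mem_of_mem_erase hb)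
        linarith
    _ ≤ ∑ b ∈ H, w b * ∑ b' ∈ H.erase b, w b' :=
        Finset.sum_le_sum_of_subset_of_nonneg (H.erase_subset x) fun b _ _ =>
          mul_nonneg (hw b) (Finset.sum_nonneg fun b' _ => hw b')
    _ = _ := by simp_rw [Finset.mul_sum]

namespace SimpleGraph

variable {V : Type*} [Fintype V] [DecidableEq V] (G : SimpleGraph V) [DecidableRel G.Adj]

/-- The paths with `4` edges whose middle vertex is `a ∈ A`, and whose second and fourth vertices
are distinct elements of `H a`, number at least `2/9` of the total weight of pairs in `H a`. -/
theorem sum_degree_mul_degree_le_card_four_paths {A B : Finset V}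
    (hadj : ∀ b ∈ B, ∀ a, G.Adj b a → a ∈ A)
    (H : V → Finset V) (hHB : ∀ a ∈ A, H a ⊆ B) (hHadj : ∀ a, ∀ b ∈ H a, G.Adj a b)
    (hHdeg : ∀ a, ∀ b ∈ H a, 3 ≤ G.degree b) :
    2 / 9 * ∑ a ∈ A, ∑ b ∈ H a, ∑ b' ∈ (H a).erase b, (G.degree b : ℝ) * G.degree b' ≤
      ({q : V × V × V × V × V |
        q.1 ∈ A ∧ q.2.2.1 ∈ A ∧ q.2.2.2.2 ∈ A ∧
        q.1 ≠ q.2.2.1 ∧ q.1 ≠ q.2.2.2.2 ∧ q.2.2.1 ≠ q.2.2.2.2 ∧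
        q.2.1 ∈ B ∧ q.2.2.2.1 ∈ B ∧ q.2.1 ≠ q.2.2.2.1 ∧
        G.Adj q.1 q.2.1 ∧ G.Adj q.2.1 q.2.2.1 ∧
        G.Adj q.2.2.1 q.2.2.2.1 ∧ G.Adj q.2.2.2.1 q.2.2.2.2}.ncard : ℝ) := by
  let T : Finset (Σ _ : V, Σ _ : V, Σ _ : V, Σ _ : V, V) :=
    A.sigma fun a => (H a).sigma fun b => ((H a).erase b).sigma fun b' =>
      ((G.neighborFinset b).erase a).sigma fun x => ((G.neighborFinset b').erase a).erase x
  let f : (Σ _ : V, Σ _ : V, Σ _ : V, Σ _ : V, V) → V × V × V × V × V :=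
    fun p => (p.2.2.2.1, p.2.1, p.1, p.2.2.1, p.2.2.2.2)
  have hf : Function.Injective f := by
    rintro ⟨a, b, c, d, e⟩ ⟨a', b', c', d', e'⟩ h
    simp only [f, Prod.mk.injEq] at h
    obtain ⟨rfl, rfl, rfl, rfl, rfl⟩ := h
    rfl
  have hcard : T.card ≤ {q : V × V × V × V × V |
        q.1 ∈ A ∧ q.2.2.1 ∈ A ∧ q.2.2.2.2 ∈ A ∧
        q.1 ≠ q.2.2.1 ∧ q.1 ≠ q.2.2.2.2 ∧ q.2.2.1 ≠ q.2.2.2.2 ∧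
        q.2.1 ∈ B ∧ q.2.2.2.1 ∈ B ∧ q.2.1 ≠ q.2.2.2.1 ∧
        G.Adj q.1 q.2.1 ∧ G.Adj q.2.1 q.2.2.1 ∧
        G.Adj q.2.2.1 q.2.2.2.1 ∧ G.Adj q.2.2.2.1 q.2.2.2.2}.ncard := by
    rw [← Finset.card_image_of_injective T hf, ← Set.ncard_coe_finset]
    refine Set.ncard_le_ncard ?_ (Set.toFinite _)
    intro q hq
    simp only [Finset.coe_image, Set.mem_image, Finset.mem_coe] at hq
    obtain ⟨⟨a, b, b', x, y⟩, hp, rfl⟩ := hq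
    simp only [T, Finset.mem_sigma, Finset.mem_erase, mem_neighborFinset] at hp
    obtain ⟨ha, hb, ⟨hne, hb'⟩, ⟨hxa, hbx⟩, hyx, hya, hby⟩ := hp
    exact ⟨hadj b (hHB a ha hb) x hbx, ha, hadj b' (hHB a ha hb') y hby, hxa, hyx.symm, hya.symm,
      hHB a ha hb, hHB a ha hb', hne.symm, hbx.symm, (hHadj a b hb).symm, hHadj a b' hb', hby⟩
  refine le_trans ?_ (Nat.cast_le.mpr hcard)
  simp only [T, Finset.card_sigma, Nat.cast_sum, Finset.mul_sum]
  refine Finset.sum_le_sum fun a _ => Finset.sum_le_sum fun b hb =>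
    Finset.sum_le_sum fun b' hb' => ?_
  have hb'H := Finset.mem_of_mem_erase hb'
  have hd : (3 : ℝ) ≤ G.degree b := by exact_mod_cast hHdeg a b hb
  have hd' : (3 : ℝ) ≤ G.degree b' := by exact_mod_cast hHdeg a b' hb'H
  have hN : (((G.neighborFinset b).erase a).card : ℝ) = G.degree b - 1 := by
    rw [Finset.cast_card_erase_of_mem (by simpa using (hHadj a b hb).symm),
      card_neighborFinset_eq_degree]
  have hN' : ∀ x, (G.degree b' : ℝ) - 2 ≤ (((G.neighborFinset b').erase a).erase x).card := by
    intro x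
    have h1 := Finset.pred_card_le_card_erase (s := (G.neighborFinset b').erase a) (a := x)
    have h2 := Finset.pred_card_le_card_erase (s := G.neighborFinset b') (a := a)
    rw [card_neighborFinset_eq_degree] at h2
    have h3 : G.degree b' ≤ (((G.neighborFinset b').erase a).erase x).card + 2 := by omega
    have h4 : (G.degree b' : ℝ) ≤ (((G.neighborFinset b').erase a).erase x).card + 2 := by
      exact_mod_cast h3
    linarith
  calc 2 / 9 * ((G.degree b : ℝ) * G.degree b')
      ≤ (G.degree b - 1) * (G.degree b' - 2) := by
        nlinarith [mul_nonneg (sub_nonneg.2 hd) (sub_nonneg.2 hd')]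
    _ = ∑ x ∈ (G.neighborFinset b).erase a, ((G.degree b' : ℝ) - 2) := by
        rw [Finset.sum_const, nsmul_eq_mul, hN]
    _ ≤ _ := Finset.sum_le_sum fun x _ => hN' x

/-- Keep at each `a ∈ A` all but one of the edges to vertices of `B` of degree at least `3`. The
total degree of the `B`-ends of these edges is at least the square of `m - 2|B| - |A|` over
`|B|`. -/
theorem sq_card_edges_sub_le_card_mul_sum_degree {A B : Finset V} (K : V → Finset V)
    (hG : G.IsBipartiteWith A B)
    (hK : ∀ a ∈ A, K a ⊆ {b ∈ G.neighborFinset a | 3 ≤ G.degree b})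
    (hcard : ∀ a ∈ A, ({b ∈ G.neighborFinset a | 3 ≤ G.degree b}).card ≤ (K a).card + 1)
    (hm : 2 * B.card + A.card ≤ G.edgeFinset.card) :
    ((G.edgeFinset.card : ℝ) - 2 * B.card - A.card) ^ 2 ≤
      B.card * ∑ a ∈ A, ∑ b ∈ K a, (G.degree b : ℝ) := by
  have hnb : ∀ b ∈ B, ∀ a, G.Adj a b → a ∈ A := fun b hb a h =>
    hG.mem_of_mem_adj' (by exact_mod_cast hb) h
  have hna : ∀ a ∈ A, ∀ b, G.Adj a b → b ∈ B := fun a ha b h =>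
    hG.mem_of_mem_adj (by exact_mod_cast ha) h
  let e : V → ℕ := fun b => {a ∈ A | b ∈ K a}.card
  have he : ∀ b, e b ≤ G.degree b := by
    intro b
    rw [← card_neighborFinset_eq_degree]
    refine Finset.card_le_card fun a ha => ?_
    rw [Finset.mem_filter] at ha
    have := hK a ha.1 ha.2
    rw [Finset.mem_filter, mem_neighborFinset] at this
    exact (mem_neighborFinset _ _ _).2 this.1.symm
  have hswap : ∀ g : V → ℝ, ∑ a ∈ A, ∑ b ∈ K a, g b = ∑ b ∈ B, e b * g b := by
    intro g
    rw [Finset.sum_comm' (t' := B) (s' := fun b => {a ∈ A | b ∈ K a})]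
    · simp [e]
    · intro a b
      simp only [Finset.mem_filter]
      refine ⟨fun h => ⟨h, ?_⟩, fun h => h.1⟩
      have := hK a h.1 h.2
      rw [Finset.mem_filter, mem_neighborFinset] at this
      exact hna a h.1 b this.1
  have hheavy : ∑ a ∈ A, ({b ∈ G.neighborFinset a | 3 ≤ G.degree b}).card =
      ∑ b ∈ B with 3 ≤ G.degree b, G.degree b := by
    simp_rw [← card_neighborFinset_eq_degree, Finset.card_eq_sum_ones]
    refine Finset.sum_comm' fun a b => ?_
    simp only [Finset.mem_filter, mem_neighborFinset, Finset.sum_const, smul_eq_mul, mul_one]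
    constructor
    · rintro ⟨ha, hab, hd⟩
      exact ⟨hab.symm, hna a ha b hab, hd⟩
    · rintro ⟨hba, hb, hd⟩
      exact ⟨hnb b hb a hba.symm, hba.symm, hd⟩
  have hedges : G.edgeFinset.card ≤
      (∑ b ∈ B with 3 ≤ G.degree b, G.degree b) + 2 * B.card := by
    rw [← isBipartiteWith_sum_degrees_eq_card_edges' hG, Finset.sum_filter, mul_comm,
      ← smul_eq_mul, ← Finset.sum_const, ← Finset.sum_add_distrib]
    refine Finset.sum_le_sum fun b _ => ?_
    split_ifs <;> omega
  have hsumK : ∑ a ∈ A, ({b ∈ G.neighborFinset a | 3 ≤ G.degree b}).card ≤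
      ∑ a ∈ A, (K a).card + A.card := by
    refine (Finset.sum_le_sum hcard).trans ?_
    simp [Finset.sum_add_distrib]
  have htotal : (G.edgeFinset.card : ℝ) - 2 * B.card - A.card ≤ ∑ b ∈ B, (e b : ℝ) := by
    have h1 := hswap fun _ => 1
    simp only [Finset.sum_const, nsmul_eq_mul, mul_one] at h1
    rw [← h1]
    have h2 : G.edgeFinset.card ≤ ∑ a ∈ A, (K a).card + A.card + 2 * B.card := by omega
    have h3 : (G.edgeFinset.card : ℝ) ≤ ∑ a ∈ A, ((K a).card : ℝ) + A.card + 2 * B.card := by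
      exact_mod_cast h2
    linarith
  have hnonneg : (0 : ℝ) ≤ G.edgeFinset.card - 2 * B.card - A.card := by
    have : (2 : ℝ) * B.card + A.card ≤ G.edgeFinset.card := by exact_mod_cast hm
    linarith
  calc ((G.edgeFinset.card : ℝ) - 2 * B.card - A.card) ^ 2
      ≤ (∑ b ∈ B, (e b : ℝ)) ^ 2 := pow_le_pow_left₀ hnonneg htotal 2
    _ ≤ B.card * ∑ b ∈ B, (e b : ℝ) ^ 2 := sq_sum_le_card_mul_sum_sq
    _ ≤ B.card * ∑ b ∈ B, (e b : ℝ) * G.degree b := by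
        gcongr with b
        rw [sq]
        gcongr
        exact he b
    _ = _ := by rw [hswap]

end SimpleGraph

/-- Supersaturation of `4`-paths `A — B — A — B — A` in a bipartite graph with
`m ≥ 50(R + L)` edges: there are at least `c·m⁴/(L·R²)` such paths. -/
theorem four_path_supersaturation :
    ∃ c : ℝ, 0 < c ∧
      ∀ (V : Type) [Fintype V] [DecidableEq V] (G : SimpleGraph V) [DecidableRel G.Adj]
        (A B : Finset V), Disjoint A B → A ∪ B = Finset.univ →
        (∀ u v : V, G.Adj u v → (u ∈ A ∧ v ∈ B) ∨ (u ∈ B ∧ v ∈ A)) →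
        ∀ (L R m : ℕ), L = A.card → R = B.card → m = G.edgeFinset.card →
          1 ≤ L → 1 ≤ R → m ≥ 50 * (R + L) →
          (({q : V × V × V × V × V |
              q.1 ∈ A ∧ q.2.2.1 ∈ A ∧ q.2.2.2.2 ∈ A ∧
              q.1 ≠ q.2.2.1 ∧ q.1 ≠ q.2.2.2.2 ∧ q.2.2.1 ≠ q.2.2.2.2 ∧
              q.2.1 ∈ B ∧ q.2.2.2.1 ∈ B ∧ q.2.1 ≠ q.2.2.2.1 ∧
              G.Adj q.1 q.2.1 ∧ G.Adj q.2.1 q.2.2.1 ∧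
              G.Adj q.2.2.1 q.2.2.2.1 ∧ G.Adj q.2.2.2.1 q.2.2.2.2}.ncard : ℝ)) ≥
            c * (m : ℝ) ^ 4 / ((L : ℝ) * (R : ℝ) ^ 2) := by
  refine ⟨1 / 72, by norm_num, ?_⟩
  intro V _ _ G _ A B hAB _ hbip L R m hL hR hm hL1 hR1 hmLR
  have hG : G.IsBipartiteWith A B :=
    ⟨by exact_mod_cast hAB, fun u v h => by exact_mod_cast hbip u v h⟩
  let H : V → Finset V := fun a => {b ∈ G.neighborFinset a | 3 ≤ G.degree b}
  have hH : ∀ a, ∀ b ∈ H a, G.Adj a b ∧ 3 ≤ G.degree b := fun a b hb => by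
    simpa [H] using hb
  choose K hKH hKcard hKsq using fun a =>
    exists_subset_sq_sum_le_sum_offDiag (H a) (fun b => (G.degree b : ℝ)) fun _ => by positivity
  have hpaths := G.sum_degree_mul_degree_le_card_four_paths (A := A) (B := B)
    (fun b hb a h => hG.symm.mem_of_mem_adj (by exact_mod_cast hb) h) H
    (fun a ha b hb => hG.mem_of_mem_adj (by exact_mod_cast ha) (hH a b hb).1)
    (fun a b hb => (hH a b hb).1) (fun a b hb => (hH a b hb).2)
  have hweight := G.sq_card_edges_sub_le_card_mul_sum_degree K hG (fun a _ => hKH a)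
    (fun a _ => hKcard a) (by omega)
  rw [← hL, ← hR, ← hm] at hweight
  set S := ∑ a ∈ A, ∑ b ∈ K a, (G.degree b : ℝ)
  have hcauchy : S ^ 2 ≤ L * ∑ a ∈ A, ∑ b ∈ H a, ∑ b' ∈ (H a).erase b,
      (G.degree b : ℝ) * G.degree b' := by
    rw [hL]
    refine sq_sum_le_card_mul_sum_sq.trans ?_
    gcongr with a
    exact hKsq a
  have hLpos : (0 : ℝ) < L := by exact_mod_cast hL1
  have hRpos : (0 : ℝ) < R := by exact_mod_cast hR1
  have hmR : (50 : ℝ) * (R + L) ≤ m := by exact_mod_cast hmLR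
  have hhalf : ((m : ℝ) / 2) ^ 2 ≤ R * S :=
    (pow_le_pow_left₀ (by positivity) (by linarith) 2).trans hweight
  have hfour : (m : ℝ) ^ 4 / 16 ≤ R ^ 2 * S ^ 2 := by
    have := pow_le_pow_left₀ (by positivity) hhalf 2
    nlinarith
  refine le_trans ?_ hpaths
  rw [div_le_iff₀ (by positivity)]
  have := mul_le_mul_of_nonneg_left hcauchy (sq_nonneg (R : ℝ))
  nlinarith
end

section
/- Fix an integer k ≥ 2 and a constant c₀ > 0, and assume the following supersaturation hypothesis: for every finite simple bipartite graph H with vertex bipartition A₀ ⊔ B₀ and m₀ edges satisfying m₀ ≥ 100·k·(|A₀| + |B₀| + (|A₀|·|B₀|)^((k+1)/(2k))), the number of copies of C_{2k} in H is at least c₀·m₀^(2k)/(|A₀|^k·|B₀|^k). Then there is a constant C > 0 (depending only on k and c₀) such that for every finite simple graph G containing t copies of C_{2k} and all vertex subsets A, B ⊆ V(G), not necessarily disjoint: e(A,B) ≤ C·(|A| + |B| + (|A|·|B|)^((k+1)/(2k)) + t^(1/(2k))·√(|A|·|B|)). -/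
open SimpleGraph

/-- The number of subgraphs of `G` isomorphic to the cycle on `n` vertices. -/
noncomputable def countCopiesOfCycle (n : ℕ) {V : Type*} (G : SimpleGraph V) : ℕ :=
  {H : G.Subgraph | Nonempty (H.coe ≃g cycleGraph n)}.ncard

/-- The number of edges of `G` with one endpoint in `A` and the other in `B`. -/
noncomputable def eCount {V : Type*} (G : SimpleGraph V) (A B : Set V) : ℕ :=
  {e ∈ G.edgeSet | ∃ u ∈ A, ∃ v ∈ B, e = s(u, v)}.ncard

/-- The unbalanced supersaturation hypothesis for `C_{2k}` with constant `c₀`. -/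
def UnbalancedSupersat (k : ℕ) (c₀ : ℝ) : Prop :=
  ∀ (W : Type) [Fintype W] [DecidableEq W] (H : SimpleGraph W) [DecidableRel H.Adj]
    (A₀ B₀ : Finset W), Disjoint A₀ B₀ → A₀ ∪ B₀ = Finset.univ →
    (∀ u v : W, H.Adj u v → (u ∈ A₀ ∧ v ∈ B₀) ∨ (u ∈ B₀ ∧ v ∈ A₀)) →
    (H.edgeFinset.card : ℝ) ≥ 100 * k * ((A₀.card : ℝ) + (B₀.card : ℝ) +
      ((A₀.card : ℝ) * (B₀.card : ℝ)) ^ (((k : ℝ) + 1) / (2 * (k : ℝ)))) →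
    (countCopiesOfCycle (2 * k) H : ℝ) ≥
      c₀ * (H.edgeFinset.card : ℝ) ^ (2 * k) / ((A₀.card : ℝ) ^ k * (B₀.card : ℝ) ^ k)

/-- Copies of a cycle in a graph inject into those of any graph containing it. -/
lemma countCopiesOfCycle_le_of_copy {V W : Type*} [Finite V] {H : SimpleGraph W}
    {G : SimpleGraph V} (f : Copy H G) (n : ℕ) :
    countCopiesOfCycle n H ≤ countCopiesOfCycle n G := by
  have hinj : Function.Injective (SimpleGraph.Subgraph.map f.toHom) := by
    intro X Y h
    ext u v
    · have := congrArg (fun Z => f u ∈ Z.verts) h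
      simpa [show ∀ a b, f a = f b ↔ a = b from fun _ _ => f.injective.eq_iff] using this
    · have := congrArg (fun Z => Z.Adj (f u) (f v)) h
      simpa [Relation.map_apply, show ∀ a b, f a = f b ↔ a = b from
        fun _ _ => f.injective.eq_iff] using this
  refine Set.ncard_le_ncard_of_injOn (SimpleGraph.Subgraph.map f.toHom) ?_ hinj.injOn
    (Set.toFinite _)
  rintro X ⟨e⟩
  exact ⟨(f.isoSubgraphMap X).symm.trans e⟩

/-- The number of vertex sets containing `u` but not `v` is a quarter of all vertex sets. -/
lemma four_mul_card_filter_mem_notMem {V : Type*} [Fintype V] [DecidableEq V] {u v : V}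
    (huv : u ≠ v) :
    4 * (Finset.univ.filter fun S : Finset V => u ∈ S ∧ v ∉ S).card =
      Fintype.card (Finset V) := by
  have h : (Finset.univ.filter fun S : Finset V => u ∈ S ∧ v ∉ S) =
      Finset.Icc {u} ({v}ᶜ : Finset V) := by
    ext S
    simp [Finset.subset_compl_singleton]
  have hsub : ({u} : Finset V) ⊆ {v}ᶜ := by simpa using huv.symm
  have hcard : 2 ≤ Fintype.card V := Fintype.one_lt_card_iff.2 ⟨u, v, huv⟩
  rw [h, Finset.card_Icc_finset hsub, Finset.card_compl, Finset.card_singleton,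
    Finset.card_singleton, Fintype.card_finset]
  obtain ⟨n, hn⟩ := Nat.exists_eq_add_of_le hcard
  rw [hn, show 2 + n - 1 - 1 = n by omega, pow_add]
  norm_num

/-- Some disjoint subsets of `A` and `B` span a quarter of the edges between `A` and `B`. -/
lemma exists_eCount_le_four_mul_eCount_diff {V : Type*} [Fintype V] (G : SimpleGraph V)
    (A B : Set V) : ∃ S : Set V, eCount G A B ≤ 4 * eCount G (A ∩ S) (B \ S) := by
  classical
  let E : Finset (Sym2 V) := {e ∈ G.edgeFinset | ∃ u ∈ A, ∃ v ∈ B, e = s(u, v)}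
  let r : Finset V → Sym2 V → Prop := fun S e => ∃ u ∈ A ∩ S, ∃ v ∈ B \ S, e = s(u, v)
  have hE : eCount G A B = E.card := by
    rw [eCount, ← Set.ncard_coe_finset]
    congr 1
    ext e
    simp [E]
  have hr (S : Finset V) : (E.bipartiteAbove r S).card ≤ eCount G (A ∩ S) (B \ S) := by
    rw [eCount, ← Set.ncard_coe_finset]
    refine Set.ncard_le_ncard ?_ (Set.toFinite _)
    intro e he
    simp only [Finset.mem_coe, Finset.mem_bipartiteAbove, E, Finset.mem_filter,
      mem_edgeFinset] at he
    exact ⟨he.1.1, he.2⟩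
  have hbelow : ∀ e ∈ E, Fintype.card (Finset V) ≤
      4 * (Finset.univ.bipartiteBelow r e).card := by
    intro e he
    simp only [E, Finset.mem_filter, mem_edgeFinset] at he
    obtain ⟨hadj, u, hu, v, hv, rfl⟩ := he
    rw [← four_mul_card_filter_mem_notMem (G.ne_of_adj hadj)]
    refine Nat.mul_le_mul_left 4 (Finset.card_le_card ?_)
    intro S hS
    simp only [Finset.mem_filter, Finset.mem_univ, true_and] at hS
    simp only [Finset.mem_bipartiteBelow, Finset.mem_univ, true_and]
    exact ⟨u, ⟨hu, hS.1⟩, v, ⟨hv, hS.2⟩, rfl⟩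
  have hsum : ∑ _S : Finset V, E.card ≤ ∑ S : Finset V, 4 * (E.bipartiteAbove r S).card := by
    rw [← Finset.mul_sum, Finset.sum_card_bipartiteAbove_eq_sum_card_bipartiteBelow,
      Finset.mul_sum, Finset.sum_const, Finset.card_univ, smul_eq_mul, mul_comm,
      ← smul_eq_mul]
    exact Finset.card_nsmul_le_sum _ _ _ hbelow
  obtain ⟨S, -, hS⟩ := Finset.exists_le_of_sum_le Finset.univ_nonempty hsum
  exact ⟨S, hE ▸ hS.trans (Nat.mul_le_mul_left 4 (hr S))⟩

/-- The edge bound for disjoint sets: either there are few edges, or supersaturation applies to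
the bipartite graph between the two sets. -/
lemma eCount_bound_of_disjoint {k : ℕ} {c₀ : ℝ} (hyp : UnbalancedSupersat k c₀)
    {V : Type} [Fintype V] (G : SimpleGraph V) {A B : Set V} (hAB : Disjoint A B) :
    (eCount G A B : ℝ) ≤ 100 * k * ((A.ncard : ℝ) + (B.ncard : ℝ) +
        ((A.ncard : ℝ) * (B.ncard : ℝ)) ^ (((k : ℝ) + 1) / (2 * (k : ℝ)))) ∨
      c₀ * (eCount G A B : ℝ) ^ (2 * k) / ((A.ncard : ℝ) ^ k * (B.ncard : ℝ) ^ k) ≤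
        countCopiesOfCycle (2 * k) G := by
  classical
  let H : SimpleGraph {x // x ∈ A ∪ B} :=
    { Adj := fun u v => G.Adj u v ∧ ((u.1 ∈ A ∧ v.1 ∈ B) ∨ (u.1 ∈ B ∧ v.1 ∈ A))
      symm := ⟨fun u v h => ⟨h.1.symm, by tauto⟩⟩
      loopless := ⟨fun u h => G.loopless.irrefl _ h.1⟩ }
  let A₀ : Finset {x // x ∈ A ∪ B} := {x | x.1 ∈ A}
  let B₀ : Finset {x // x ∈ A ∪ B} := {x | x.1 ∈ B}
  let f : Copy H G := ⟨⟨Subtype.val, fun h => h.1⟩, Subtype.val_injective⟩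
  have hA : A₀.card = A.ncard := by
    rw [← Set.ncard_coe_finset, ← Set.ncard_image_of_injective _ Subtype.val_injective]
    congr 1
    ext x
    simp +contextual [A₀]
  have hB : B₀.card = B.ncard := by
    rw [← Set.ncard_coe_finset, ← Set.ncard_image_of_injective _ Subtype.val_injective]
    congr 1
    ext x
    simp +contextual [B₀]
  have hm : H.edgeFinset.card = eCount G A B := by
    rw [← Set.ncard_coe_finset,
      ← Set.ncard_image_of_injective _ (Sym2.map.injective Subtype.val_injective), eCount]
    congr 1
    ext e
    simp only [coe_edgeFinset, Set.mem_image, Set.mem_ofPred_eq]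
    constructor
    · rintro ⟨e, he, rfl⟩
      induction e using Sym2.ind with
      | _ u v =>
        obtain ⟨h, ⟨hu, hv⟩ | ⟨hu, hv⟩⟩ := he
        · exact ⟨h, u, hu, v, hv, rfl⟩
        · exact ⟨h, v, hv, u, hu, Sym2.eq_swap⟩
    · rintro ⟨he, u, hu, v, hv, rfl⟩
      exact ⟨s(⟨u, Or.inl hu⟩, ⟨v, Or.inr hv⟩), ⟨he, Or.inl ⟨hu, hv⟩⟩, rfl⟩
  have key := hyp _ H A₀ B₀
    (Finset.disjoint_filter.2 fun x _ ha hb => Set.disjoint_left.1 hAB ha hb)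
    (by simp [Finset.ext_iff, A₀, B₀])
    (fun u v h => by simpa [A₀, B₀] using h.2)
  rw [hA, hB, hm] at key
  refine (le_total _ _).imp id fun h => (key h).trans ?_
  exact_mod_cast countCopiesOfCycle_le_of_copy f _

/-- Solving the supersaturation inequality for the number of edges. -/
lemma le_of_supersat_inequality {k : ℕ} (hk : k ≠ 0) {c m a b t : ℝ} (hc : 0 < c) (ha : 0 < a)
    (hb : 0 < b) (ht : 0 ≤ t) (h : c * m ^ (2 * k) / (a ^ k * b ^ k) ≤ t) :
    m ≤ (1 / c) ^ (1 / (2 * (k : ℝ))) * (t ^ (1 / (2 * (k : ℝ))) * √(a * b)) := by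
  have hexp : 1 / (2 * (k : ℝ)) = ((2 * k : ℕ) : ℝ)⁻¹ := by push_cast; exact one_div _
  have h2k : 2 * k ≠ 0 := by omega
  rw [hexp]
  refine le_of_pow_le_pow_left₀ h2k (by positivity) ?_
  rw [mul_pow, mul_pow, Real.rpow_inv_natCast_pow (by positivity) h2k,
    Real.rpow_inv_natCast_pow ht h2k, pow_mul (√(a * b)), Real.sq_sqrt (by positivity), mul_pow]
  rw [div_le_iff₀ (by positivity)] at h
  rw [one_div, ← div_eq_inv_mul, le_div_iff₀ hc]
  linarith

/-- Under the unbalanced supersaturation hypothesis, `e(A,B)` is bounded in terms of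
`|A|`, `|B|` and the number `t` of `C_{2k}`'s in `G`. -/
theorem eAB_bound_of_supersat (k : ℕ) (hk : 2 ≤ k) (c₀ : ℝ) (hc₀ : 0 < c₀)
    (hyp : UnbalancedSupersat k c₀) :
    ∃ C : ℝ, 0 < C ∧
      ∀ (V : Type) [Fintype V] (G : SimpleGraph V) (A B : Set V),
        (eCount G A B : ℝ) ≤
          C * ((A.ncard : ℝ) + (B.ncard : ℝ) +
            ((A.ncard : ℝ) * (B.ncard : ℝ)) ^ (((k : ℝ) + 1) / (2 * (k : ℝ))) +
            (countCopiesOfCycle (2 * k) G : ℝ) ^ (1 / (2 * (k : ℝ))) *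
              Real.sqrt ((A.ncard : ℝ) * (B.ncard : ℝ))) := by
  set D : ℝ := (1 / c₀) ^ (1 / (2 * (k : ℝ)))
  have hD : 0 ≤ D := by positivity
  have hk₀ : (0 : ℝ) < k := by exact_mod_cast (by omega : 0 < k)
  refine ⟨4 * (100 * k + D), by positivity, fun V _ G A B => ?_⟩
  obtain ⟨S, hS⟩ := exists_eCount_le_four_mul_eCount_diff G A B
  have hA : ((A ∩ S).ncard : ℝ) ≤ A.ncard := by
    exact_mod_cast Set.ncard_le_ncard Set.inter_subset_left (Set.toFinite _)
  have hB : ((B \ S).ncard : ℝ) ≤ B.ncard := by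
    exact_mod_cast Set.ncard_le_ncard Set.sdiff_subset (Set.toFinite _)
  have hS' : (eCount G A B : ℝ) ≤ 4 * eCount G (A ∩ S) (B \ S) := by exact_mod_cast hS
  have hdisj : Disjoint (A ∩ S) (B \ S) :=
    Set.disjoint_left.2 fun x hx hy => hy.2 hx.2
  refine hS'.trans ?_
  rw [mul_assoc]
  refine mul_le_mul_of_nonneg_left ?_ (by norm_num)
  set P : ℝ := ((A.ncard : ℝ) * (B.ncard : ℝ)) ^ (((k : ℝ) + 1) / (2 * (k : ℝ)))
  set Q : ℝ := (countCopiesOfCycle (2 * k) G : ℝ) ^ (1 / (2 * (k : ℝ))) *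
    Real.sqrt ((A.ncard : ℝ) * (B.ncard : ℝ))
  have hP : 0 ≤ P := by positivity
  have hQ : 0 ≤ Q := by positivity
  by_cases hedge : eCount G (A ∩ S) (B \ S) = 0
  · rw [hedge, Nat.cast_zero]
    positivity
  obtain ⟨e, -, u, hu, v, hv, -⟩ := Set.nonempty_of_ncard_ne_zero hedge
  have ha : (0 : ℝ) < (A ∩ S).ncard := by
    exact_mod_cast (Set.ncard_pos (Set.toFinite _)).2 ⟨u, hu⟩
  have hb : (0 : ℝ) < (B \ S).ncard := by
    exact_mod_cast (Set.ncard_pos (Set.toFinite _)).2 ⟨v, hv⟩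
  rcases eCount_bound_of_disjoint hyp G hdisj with h | h
  · calc (eCount G (A ∩ S) (B \ S) : ℝ) ≤ 100 * k * ((A.ncard : ℝ) + B.ncard + P) :=
          h.trans (by simp only [P]; gcongr)
      _ ≤ (100 * k + D) * ((A.ncard : ℝ) + B.ncard + P + Q) :=
          mul_le_mul (by linarith) (by linarith) (by positivity) (by positivity)
  · have h' := le_of_supersat_inequality (by omega) hc₀ ha hb
      (Nat.cast_nonneg _) h
    calc (eCount G (A ∩ S) (B \ S) : ℝ) ≤ D * Q := h'.trans (by simp only [D, Q]; gcongr)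
      _ ≤ (100 * k + D) * ((A.ncard : ℝ) + B.ncard + P + Q) :=
          mul_le_mul (by linarith) (by linarith) (by positivity) (by positivity)
end
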